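/- arXiv:1902.07752 — 2 statements merged into one kernel-verified Lean document; each statement's English description precedes it below -/
import Mathlib

section
/- Let X be a topological space equipped with an ℕ-valued pseudometric d : X × X → ℕ (d(x,x) = 0, d(x,y) = d(y,x), d(x,z) ≤ d(x,y) + d(y,z)); write B̄(y,r) = {x ∈ X : d(x,y) ≤ r}. Fix x₀ ∈ X and assume: every closed ball B̄(y,r) is closed in X, and the topology of X is final with respect to the balls B̄(x₀,n), n ∈ ℕ, i.e. A ⊆ X is closed if and only if A ∩ B̄(x₀,n) is closed for every n (in particular ⋃ₙ B̄(x₀,n) = X). Let S ⊆ X and N₀ ∈ ℕ be such that (i) for every x ∈ X there exists y ∈ S with d(x,y) ≤ N₀, and (ii) S ∩ B̄(x₀,m) is finite for every m ∈ ℕ. Then the set U := X \ ⋃_{y ∈ S, d(x₀,y) > N₀} B̄(y,N₀) is an open subset of X which contains x₀ and is contained in the ball B̄(x₀, 2N₀). -/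
/-- Abstract form of Proposition 4.5: with `d` an `ℕ`-valued pseudometric on the topological
space `X`, closed balls closed, the topology final with respect to the balls around `x₀`, and
`S ⊆ X` an `N₀`-coarsely dense set meeting every ball around `x₀` in a finite set, the
complement `U` of the union of the closed `N₀`-balls around the points `y ∈ S` with
`d x₀ y > N₀` is an open neighbourhood of `x₀` contained in the ball of radius `2N₀`
around `x₀`. -/
theorem bounded_open_neighbourhood {X : Type*} [TopologicalSpace X] (d : X → X → ℕ)
    (hd_refl : ∀ x, d x x = 0)
    (hd_symm : ∀ x y, d x y = d y x)
    (hd_triangle : ∀ x y z, d x z ≤ d x y + d y z)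
    (hballs_closed : ∀ (y : X) (r : ℕ), IsClosed {x : X | d x y ≤ r})
    (x₀ : X)
    (hfinal : ∀ A : Set X, IsClosed A ↔ ∀ n : ℕ, IsClosed (A ∩ {x : X | d x x₀ ≤ n}))
    (S : Set X) (N₀ : ℕ)
    (hdense : ∀ x : X, ∃ y ∈ S, d x y ≤ N₀)
    (hSfin : ∀ m : ℕ, (S ∩ {x : X | d x x₀ ≤ m}).Finite) :
    IsOpen (Set.univ \ ⋃ y ∈ {y ∈ S | d x₀ y > N₀}, {x : X | d x y ≤ N₀}) ∧
      x₀ ∈ Set.univ \ ⋃ y ∈ {y ∈ S | d x₀ y > N₀}, {x : X | d x y ≤ N₀} ∧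
      (Set.univ \ ⋃ y ∈ {y ∈ S | d x₀ y > N₀}, {x : X | d x y ≤ N₀}) ⊆
        {x : X | d x x₀ ≤ 2 * N₀} := by
  have hclosed : IsClosed (⋃ y ∈ {y ∈ S | d x₀ y > N₀}, {x : X | d x y ≤ N₀}) := by
    refine (hfinal _).2 fun n => ?_
    -- Only the finitely many centres within `n + N₀` of `x₀` contribute to the ball of radius `n`.
    have hrestrict : (⋃ y ∈ {y ∈ S | d x₀ y > N₀}, {x : X | d x y ≤ N₀}) ∩ {x | d x x₀ ≤ n} =
        (⋃ y ∈ {y ∈ S ∩ {x | d x x₀ ≤ n + N₀} | d x₀ y > N₀}, {x : X | d x y ≤ N₀}) ∩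
          {x | d x x₀ ≤ n} := by
      ext x
      simp only [Set.mem_inter_iff, Set.mem_iUnion, Set.mem_ofPred_eq, exists_prop]
      constructor
      · rintro ⟨⟨y, ⟨hyS, hy⟩, hxy⟩, hx⟩
        have h_tri := hd_triangle y x x₀
        have h_symm := hd_symm y x
        exact ⟨⟨y, ⟨⟨hyS, by omega⟩, hy⟩, hxy⟩, hx⟩
      · rintro ⟨⟨y, ⟨⟨hyS, -⟩, hy⟩, hxy⟩, hx⟩
        exact ⟨⟨y, ⟨hyS, hy⟩, hxy⟩, hx⟩
    rw [hrestrict]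
    exact (((hSfin (n + N₀)).subset fun y hy => hy.1).isClosed_biUnion
      fun y _ => hballs_closed y N₀).inter (hballs_closed x₀ n)
  refine ⟨isOpen_univ.sdiff hclosed, ⟨Set.mem_univ _, fun hx => ?_⟩, fun x hx => ?_⟩
  · obtain ⟨y, ⟨-, hy⟩, hxy⟩ := Set.mem_iUnion₂.1 hx
    exact absurd hxy (not_le.2 hy)
  · obtain ⟨y, hyS, hxy⟩ := hdense x
    have hy : d x₀ y ≤ N₀ := not_lt.1 fun hlt => hx.2 (Set.mem_iUnion₂.2 ⟨y, ⟨hyS, hlt⟩, hxy⟩)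
    have h_tri := hd_triangle x y x₀
    have h_symm := hd_symm y x₀
    change d x x₀ ≤ 2 * N₀
    omega
end

section
/- Let X be a T₁ topological space together with an increasing sequence X₀ ⊆ X₁ ⊆ ⋯ of closed subsets with ⋃ₙ Xₙ = X, such that each Xₙ with its subspace topology is a Noetherian topological space and the topology of X is final with respect to the Xₙ, i.e. A ⊆ X is closed if and only if A ∩ Xₙ is closed in Xₙ for every n. Then for a subset Y ⊆ X the following are equivalent: (i) Y ⊆ Xₙ for some n; (ii) Y is contained in some quasi-compact subset of X. Moreover, if these hold then Y itself is quasi-compact. -/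
open TopologicalSpace

/-- In a `T₁` space whose topology is coherent with an increasing exhaustion by subsets, every
compact subset is contained in one member of the exhaustion. -/
theorem IsCompact.subset_of_monotone_exhaustion {X : Type*} [TopologicalSpace X] [T1Space X]
    {S : ℕ → Set X} (hS_mono : Monotone S) (hS_union : ⋃ n, S n = Set.univ)
    (hS_final : ∀ A : Set X, (∀ n, IsClosed ((Subtype.val : S n → X) ⁻¹' A)) → IsClosed A)
    {K : Set X} (hK : IsCompact K) : ∃ n, K ⊆ S n := by
  by_contra! h
  simp only [Set.not_subset] at h
  choose x hxK hxS using h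
  have hclosed (m : ℕ) : IsClosed (x '' Set.Ici m) := by
    refine hS_final _ fun n ↦ Set.Finite.isClosed ?_
    refine Set.Finite.of_finite_image (f := Subtype.val) ?_ Subtype.val_injective.injOn
    refine ((Set.finite_Iio n).image x).subset ?_
    rintro _ ⟨⟨_, hy⟩, ⟨k, -, rfl⟩, rfl⟩
    exact ⟨k, not_le.mp fun hnk ↦ hxS k (hS_mono hnk hy), rfl⟩
  have hdir : Directed (· ⊇ ·) fun m ↦ x '' Set.Ici m :=
    Antitone.directed_ge fun _ _ hab ↦ Set.image_mono (Set.Ici_subset_Ici.mpr hab)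
  have hempty : K ∩ ⋂ m, x '' Set.Ici m = ∅ := by
    refine Set.eq_empty_of_forall_notMem fun y hy ↦ ?_
    obtain ⟨n, hn⟩ := Set.mem_iUnion.mp (hS_union.symm ▸ Set.mem_univ y)
    obtain ⟨k, hnk, rfl⟩ := Set.mem_iInter.mp hy.2 n
    exact hxS k (hS_mono hnk hn)
  obtain ⟨m, hm⟩ := hK.elim_directed_family_closed _ hclosed hempty hdir
  exact Set.notMem_empty (x m) (hm ▸ ⟨hxK m, m, Set.self_mem_Ici, rfl⟩)

/-- Abstract form of Lemma 4.1: let `X` be a `T₁` space which is the increasing union of closed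
subsets `Xₙ`, each Noetherian in the subspace topology, such that the topology of `X` is final
with respect to the `Xₙ`. Then a subset `Y ⊆ X` is contained in some `Xₙ` iff it is contained
in some quasi-compact subset of `X`, and in that case `Y` is itself quasi-compact. -/
theorem bounded_iff_relatively_quasiCompact {X : Type*} [TopologicalSpace X] [T1Space X]
    (Xn : ℕ → Set X)
    (hXn_closed : ∀ n, IsClosed (Xn n))
    (hXn_mono : Monotone Xn)
    (hXn_union : ⋃ n, Xn n = Set.univ)
    (hXn_noeth : ∀ n, NoetherianSpace (Xn n))
    (hfinal : ∀ A : Set X, IsClosed A ↔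
      ∀ n, IsClosed ((Subtype.val : Xn n → X) ⁻¹' A))
    (Y : Set X) :
    ((∃ n, Y ⊆ Xn n) ↔ (∃ K : Set X, IsCompact K ∧ Y ⊆ K)) ∧
      ((∃ n, Y ⊆ Xn n) → IsCompact Y) := by
  have hcompact (n : ℕ) {Z : Set X} (hZ : Z ⊆ Xn n) : IsCompact Z :=
    (noetherianSpace_set_iff _).mp (hXn_noeth n) Z hZ
  refine ⟨⟨fun ⟨n, hn⟩ ↦ ⟨Xn n, hcompact n subset_rfl, hn⟩, fun ⟨K, hK, hYK⟩ ↦ ?_⟩,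
    fun ⟨n, hn⟩ ↦ hcompact n hn⟩
  obtain ⟨n, hn⟩ := hK.subset_of_monotone_exhaustion hXn_mono hXn_union fun A ↦ (hfinal A).mpr
  exact ⟨n, hYK.trans hn⟩
end
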